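/- Consider a discrete-time controlled system (S, U, F, ℓ) which is exponentially controllable with overshoot C ≥ 1 and decay rate σ ∈ (0,1). Fix a horizon N ≥ 1, an initial state x_0 ∈ S, and a control sequence u* attaining the infimum for horizon N from x_0, i.e. J_N(x_0, u*) = V_N(x_0); let x*_n denote the associated optimal trajectory and set λ_n = ℓ(x*_n, u*_n) for n = 0, …, N−1. Then for every k = 0, …, N−1 one has the tail estimate Σ_{n=k}^{N-1} λ_n ≤ C · ((1 − σ^{N-k})/(1 − σ)) · λ_k. -/

import Mathlib

open Finset

/-- Trajectory of the discrete-time controlled system `x_{n+1} = F (x_n, u_n)`. -/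
def traj {S U : Type*} (F : S → U → S) (x : S) (u : ℕ → U) : ℕ → S
  | 0 => x
  | n + 1 => F (traj F x u n) (u n)

/-- Finite-horizon cost `J_N(x,u) = Σ_{n=0}^{N-1} ℓ(x_n, u_n)`. -/
noncomputable def costJ {S U : Type*} (F : S → U → S) (ℓ : S → U → ℝ)
    (N : ℕ) (x : S) (u : ℕ → U) : ℝ :=
  ∑ n ∈ Finset.range N, ℓ (traj F x u n) (u n)

/-- Finite-horizon value function `V_N(x) = inf_u J_N(x,u)`. -/
noncomputable def valueV {S U : Type*} (F : S → U → S) (ℓ : S → U → ℝ)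
    (N : ℕ) (x : S) : ℝ :=
  ⨅ u : ℕ → U, costJ F ℓ N x u

/-- Pointwise optimal running cost `ℓ*(x) = inf_{u ∈ U} ℓ(x,u)`. -/
noncomputable def ellStar {S U : Type*} (ℓ : S → U → ℝ) (x : S) : ℝ :=
  ⨅ u : U, ℓ x u

/-- The control sequence that follows `u` before time `k` and `v`, started afresh, from time `k`. -/
def spliceControl {U : Type*} (u : ℕ → U) (k : ℕ) (v : ℕ → U) (n : ℕ) : U :=
  if n < k then u n else v (n - k)

theorem spliceControl_of_lt {U : Type*} (u v : ℕ → U) {k n : ℕ} (h : n < k) :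
    spliceControl u k v n = u n := if_pos h

theorem spliceControl_add {U : Type*} (u v : ℕ → U) (k m : ℕ) :
    spliceControl u k v (k + m) = v m := by
  simp [spliceControl]

theorem traj_spliceControl_of_le {S U : Type*} (F : S → U → S) (x : S) (u v : ℕ → U)
    {k n : ℕ} (h : n ≤ k) : traj F x (spliceControl u k v) n = traj F x u n := by
  induction n with
  | zero => rfl
  | succ n ih => rw [traj, traj, ih (by omega), spliceControl_of_lt u v (by omega)]

theorem traj_spliceControl_add {S U : Type*} (F : S → U → S) (x : S) (u v : ℕ → U) (k m : ℕ) :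
    traj F x (spliceControl u k v) (k + m) = traj F (traj F x u k) v m := by
  induction m with
  | zero => exact traj_spliceControl_of_le F x u v le_rfl
  | succ m ih => rw [← Nat.add_assoc, traj, traj, ih, spliceControl_add]

theorem costJ_spliceControl {S U : Type*} (F : S → U → S) (ℓ : S → U → ℝ) (x : S)
    (u v : ℕ → U) (k M : ℕ) :
    costJ F ℓ (k + M) x (spliceControl u k v) =
      costJ F ℓ k x u + costJ F ℓ M (traj F x u k) v := by
  unfold costJ
  rw [Finset.sum_range_add]
  congr 1
  · refine Finset.sum_congr rfl fun n hn => ?_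
    have hn := Finset.mem_range.mp hn
    rw [traj_spliceControl_of_le F x u v hn.le, spliceControl_of_lt u v hn]
  · simp only [traj_spliceControl_add, spliceControl_add]

theorem valueV_le_costJ {S U : Type*} (F : S → U → S) {ℓ : S → U → ℝ}
    (hℓ : ∀ x u, 0 ≤ ℓ x u) (N : ℕ) (x : S) (u : ℕ → U) :
    valueV F ℓ N x ≤ costJ F ℓ N x u := by
  refine ciInf_le ⟨0, ?_⟩ u
  rintro _ ⟨w, rfl⟩
  exact Finset.sum_nonneg fun _ _ => hℓ _ _

theorem ellStar_le {S U : Type*} {ℓ : S → U → ℝ} (hℓ : ∀ x u, 0 ≤ ℓ x u) (x : S) (u : U) :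
    ellStar ℓ x ≤ ℓ x u := by
  refine ciInf_le ⟨0, ?_⟩ u
  rintro _ ⟨w, rfl⟩
  exact hℓ _ _

/-- The tail from time `k` of an optimal trajectory costs no more than any control sequence
started at the state reached at time `k`. -/
theorem sum_Ico_le_costJ_of_optimal {S U : Type*} (F : S → U → S) {ℓ : S → U → ℝ}
    (hℓ : ∀ x u, 0 ≤ ℓ x u) {N k : ℕ} (hk : k ≤ N) {x : S} {u : ℕ → U}
    (hopt : costJ F ℓ N x u = valueV F ℓ N x) (v : ℕ → U) :
    ∑ n ∈ Finset.Ico k N, ℓ (traj F x u n) (u n) ≤ costJ F ℓ (N - k) (traj F x u k) v := by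
  have hle := valueV_le_costJ F hℓ N x (spliceControl u k v)
  have hsplice := costJ_spliceControl F ℓ x u v k (N - k)
  rw [Nat.add_sub_cancel' hk] at hsplice
  have hsplit := Finset.sum_range_add_sum_Ico (fun n => ℓ (traj F x u n) (u n)) hk
  rw [← hopt, hsplice] at hle
  unfold costJ at hle ⊢
  linarith

theorem costJ_le_of_exponential_bound {S U : Type*} (F : S → U → S) (ℓ : S → U → ℝ)
    {C σ L : ℝ} (hσ : σ ≠ 1) {x : S} {v : ℕ → U}
    (hv : ∀ n, ℓ (traj F x v n) (v n) ≤ C * σ ^ n * L) (M : ℕ) :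
    costJ F ℓ M x v ≤ C * ((1 - σ ^ M) / (1 - σ)) * L := by
  refine (Finset.sum_le_sum fun n _ => hv n).trans_eq ?_
  rw [← Finset.sum_mul, ← Finset.mul_sum, geom_sum_eq hσ, ← neg_sub 1 (σ ^ M), ← neg_sub 1 σ,
    neg_div_neg_eq]

/-- Estimate (4.2) along an optimal trajectory (after Grüne, Proposition 4.1):
any tail of the optimal running costs `λ_n = ℓ(x*_n, u*_n)` is bounded via
exponential controllability, `Σ_{n=k}^{N-1} λ_n ≤ C (1 − σ^{N−k})/(1 − σ) λ_k`. -/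
theorem optimal_trajectory_tail_estimate
    {S U : Type*} [Nonempty U] (F : S → U → S) (ℓ : S → U → ℝ)
    (hℓ : ∀ x u, 0 ≤ ℓ x u)
    (C σ : ℝ) (hC : 1 ≤ C) (hσ0 : 0 < σ) (hσ1 : σ < 1)
    (hexp : ∀ x : S, ∃ u : ℕ → U,
      ∀ n : ℕ, ℓ (traj F x u n) (u n) ≤ C * σ ^ n * ellStar ℓ x)
    (N : ℕ) (hN : 1 ≤ N) (x₀ : S) (ustar : ℕ → U)
    (hopt : costJ F ℓ N x₀ ustar = valueV F ℓ N x₀)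
    (lam : ℕ → ℝ) (hlam : ∀ n, lam n = ℓ (traj F x₀ ustar n) (ustar n)) :
    ∀ k < N, ∑ n ∈ Finset.Ico k N, lam n ≤
      C * ((1 - σ ^ (N - k)) / (1 - σ)) * lam k := by
  intro k hk
  obtain ⟨v, hv⟩ := hexp (traj F x₀ ustar k)
  have hfactor : 0 ≤ C * ((1 - σ ^ (N - k)) / (1 - σ)) :=
    mul_nonneg (by linarith)
      (div_nonneg (sub_nonneg.2 (pow_le_one₀ hσ0.le hσ1.le)) (by linarith))
  simp only [hlam]
  calc ∑ n ∈ Finset.Ico k N, ℓ (traj F x₀ ustar n) (ustar n)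
      ≤ costJ F ℓ (N - k) (traj F x₀ ustar k) v :=
        sum_Ico_le_costJ_of_optimal F hℓ hk.le hopt v
    _ ≤ C * ((1 - σ ^ (N - k)) / (1 - σ)) * ellStar ℓ (traj F x₀ ustar k) :=
        costJ_le_of_exponential_bound F ℓ hσ1.ne hv _
    _ ≤ C * ((1 - σ ^ (N - k)) / (1 - σ)) * ℓ (traj F x₀ ustar k) (ustar k) :=
        mul_le_mul_of_nonneg_left (ellStar_le hℓ _ _) hfactor
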